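/- Let n ≥ 1, k ∈ ℤ^n with k ≥ 0, and λ = B_1|…|B_l an ordered partition of A_k. Then λ ∈ P_{⊞^k} if and only if for every i ∈ {1,…,n} and all j < j' in {1,…,k_i}, whenever (i,j) ∈ B_r and (i,j') ∈ B_{r'} one has r < r'. -/

import Mathlib

section Core

variable {A : Type*} [DecidableEq A] [Fintype A]

/-- A cube of the standard `A`-cube: `none` means `*`, `some true` means `1`,
`some false` means `0`. -/
abbrev Cube (A : Type*) := A → Option Bool

/-- The cube `c(O, S, rest)` with value `1` on `O`, `*` on `S` and `0` elsewhere. -/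
def cubeOn (O S : Finset A) : Cube A := fun a =>
  if a ∈ S then none else if a ∈ O then some true else some false

/-- An `A`-cubical complex: a set of cubes closed under the face maps, i.e. under
replacing any occurrence of `*` by `0` or `1`. -/
def IsComplex (K : Set (Cube A)) : Prop :=
  ∀ c ∈ K, ∀ a : A, c a = none → ∀ ε : Bool, Function.update c a (some ε) ∈ K

/-- Union of the blocks of a list of finsets. -/
def blocksUnion (L : List (Finset A)) : Finset A := L.foldr (· ∪ ·) ∅

/-- `L` is an ordered partition of `S`: a sequence of nonempty pairwise disjoint
subsets whose union is `S`. -/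
def IsOPart (S : Finset A) (L : List (Finset A)) : Prop :=
  (∀ B ∈ L, B.Nonempty) ∧
    List.Pairwise (fun B C : Finset A => Disjoint B C) L ∧ blocksUnion L = S

/-- The set `P_K` of ordered partitions `L = B₁|…|B_l` of `S` such that each cube
`c((O ∪ B₁∪…∪B_{i-1}), B_i, rest)` belongs to `K`.  Here `O` records the part of the
ambient set on which the cubes take the fixed value `1` (used for the restrictions
`K|_B^ε`); for the full complex take `O = ∅`, `S = univ`. -/
def PK (K : Set (Cube A)) (O S : Finset A) : Set (List (Finset A)) :=
  {L | IsOPart S L ∧ ∀ (i : ℕ) (h : i < L.length),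
    cubeOn (O ∪ blocksUnion (L.take i)) (L[i]'h) ∈ K}

/-- `x` refines `y`: the blocks of `y` are obtained by uniting consecutive blocks of `x`. -/
def Refines (x y : List (Finset A)) : Prop :=
  ∃ LL : List (List (Finset A)), (∀ l ∈ LL, l ≠ []) ∧
    x = LL.flatten ∧ y = LL.map blocksUnion

/-- Dimension of an ordered partition: `Σ (#Bᵢ - 1)`. -/
def pdim (L : List (Finset A)) : ℕ := (L.map fun B => B.card - 1).sum

/-- The facet relation on ordered partitions. -/
def PFacet (x y : List (Finset A)) : Prop :=
  Refines x y ∧ x ≠ y ∧ pdim y = pdim x + 1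

/-- A cycle of a discrete vector field on a poset of ordered partitions. -/
def PCycle (V : Set (List (Finset A) × List (Finset A))) (k : ℕ)
    (a : Fin (k + 1) → List (Finset A)) (b : Fin k → List (Finset A)) : Prop :=
  0 < k ∧ a 0 = a (Fin.last k) ∧
    ∀ i : Fin k, (a i.castSucc, b i) ∈ V ∧ (a i.succ, b i) ∉ V ∧ PFacet (a i.succ) (b i)

/-- A discrete vector field on ordered partitions is a gradient field if it has no cycle. -/
def PGradient (V : Set (List (Finset A) × List (Finset A))) : Prop :=
  ∀ k a b, ¬ PCycle V k a b

/-- Critical cells of a discrete vector field `V` on the set of cells `S`. -/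
def CritOn (S : Set (List (Finset A)))
    (V : Set (List (Finset A) × List (Finset A))) : Set (List (Finset A)) :=
  {x | x ∈ S ∧ ∀ p ∈ V, p.1 ≠ x ∧ p.2 ≠ x}

end Core
section Eucl

variable {n : ℕ}

/-- The set `A_k = {(i,j) : 1 ≤ i ≤ n, 1 ≤ j ≤ k_i}`; the element `⟨i, j⟩` with
`j : Fin (k i)` represents the pair `(i, j+1)` of the paper. -/
abbrev AkT (k : Fin n → ℕ) := Σ i : Fin n, Fin (k i)

/-- The value `j` of an element `(i,j) ∈ A_k`, as an integer. -/
def jval {k : Fin n → ℕ} (p : AkT k) : ℤ := ((p.2 : ℕ) : ℤ) + 1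

/-- `[a,b]` is an elementary cube: `a ≤ b ≤ a + 1` coordinatewise. -/
def IsElemCube (a b : Fin n → ℤ) : Prop := a ≤ b ∧ ∀ i, b i ≤ a i + 1

/-- The cube `i_k([a,b])` of the standard `A_k`-cube associated to an elementary
cube `[a,b] ⊆ [0,k]`. -/
def ik (k : Fin n → ℕ) (a b : Fin n → ℤ) : Cube (AkT k) := fun p =>
  if b p.1 < jval p then some false
  else if jval p ≤ a p.1 then some true
  else none

/-- `⊞^k`: the `A_k`-cubical complex of images under `i_k` of all elementary cubes
contained in `[0,k]`. -/
def boxK (k : Fin n → ℕ) : Set (Cube (AkT k)) :=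
  {c | ∃ a b : Fin n → ℤ, IsElemCube a b ∧ 0 ≤ a ∧ (∀ i, b i ≤ (k i : ℤ)) ∧
    c = ik k a b}

/-- The multiset `B̄` over `{1,…,n}` associated to `B ⊆ A_k`, as its multiplicity
function: `i` has multiplicity `#{j : (i,j) ∈ B}`. -/
def mulOf {k : Fin n → ℕ} (B : Finset (AkT k)) : Fin n → ℕ := fun i =>
  (B.filter fun p => p.1 = i).card

/-- Sum of the multiplicity functions of a list of multisets over `{1,…,n}`. -/
def sumMul (Lb : List (Fin n → ℕ)) : Fin n → ℕ := fun i =>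
  (Lb.map fun c => c i).sum

/-- An ordered partition of the multiset `[k]`: a sequence of nonempty multisets
over `{1,…,n}` (given by multiplicity functions) summing to `k`. -/
def IsMPart (k : Fin n → ℕ) (Lb : List (Fin n → ℕ)) : Prop :=
  (∀ c ∈ Lb, c ≠ 0) ∧ sumMul Lb = k

/-- A proper ordered partition of `[k]`: all blocks are sets. -/
def IsProperMPart (k : Fin n → ℕ) (Lb : List (Fin n → ℕ)) : Prop :=
  IsMPart k Lb ∧ ∀ c ∈ Lb, ∀ i, c i ≤ 1

end Eucl

theorem mem_blocksUnion {A : Type*} [DecidableEq A] (p : A) (L : List (Finset A)) :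
    p ∈ blocksUnion L ↔ ∃ B ∈ L, p ∈ B := by
  induction L with
  | nil => simp [blocksUnion]
  | cons B L ih =>
    have h : blocksUnion (B :: L) = B ∪ blocksUnion L := rfl
    simp [h, ih]

theorem mem_blocksUnion_take {A : Type*} [DecidableEq A] (p : A) (L : List (Finset A)) (r : ℕ) :
    p ∈ blocksUnion (L.take r) ↔ ∃ (s : ℕ) (hs : s < L.length), s < r ∧ p ∈ L[s] := by
  rw [mem_blocksUnion]
  constructor
  · rintro ⟨B, hB, hp⟩
    obtain ⟨s, hs, rfl⟩ := List.mem_take_iff_getElem.1 hB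
    exact ⟨s, by omega, by omega, hp⟩
  · rintro ⟨s, hs, hsr, hp⟩
    exact ⟨L[s], List.mem_take_iff_getElem.2 ⟨s, by omega, rfl⟩, hp⟩

theorem index_unique {A : Type*} {L : List (Finset A)}
    (hL : L.Pairwise fun B C : Finset A => Disjoint B C) {p : A} {r s : ℕ}
    (hr : r < L.length) (hs : s < L.length) (hpr : p ∈ L[r]) (hps : p ∈ L[s]) : r = s := by
  rw [List.pairwise_iff_getElem] at hL
  rcases lt_trichotomy r s with h | h | h
  · exact absurd hps (Finset.disjoint_left.1 (hL r s hr hs h) hpr)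
  · exact h
  · exact absurd hpr (Finset.disjoint_left.1 (hL s r hs hr h) hps)

/-- A down-closed subset of `Fin m` is the initial segment of length its cardinality. -/
theorem mem_iff_lt_card_of_isLowerSet {m : ℕ} {S : Finset (Fin m)}
    (hS : IsLowerSet (S : Set (Fin m))) (x : Fin m) : x ∈ S ↔ (x : ℕ) < S.card := by
  constructor
  · intro hx
    have h : Finset.Iic x ⊆ S := fun y hy => hS (Finset.mem_Iic.1 hy) hx
    simpa [Nat.succ_le_iff] using Finset.card_le_card h
  · intro h
    by_contra hx
    have hsub : S ⊆ Finset.Iio x := fun y hy =>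
      Finset.mem_Iio.2 (lt_of_not_ge fun hxy => hx (hS hxy hy))
    have := Finset.card_le_card hsub
    rw [Fin.card_Iio] at this
    omega

/-- The elements of `B ⊆ A_k` in the `i`-th column. -/
def column {n : ℕ} {k : Fin n → ℕ} (B : Finset (AkT k)) (i : Fin n) : Finset (Fin (k i)) :=
  Finset.univ.filter fun j => (⟨i, j⟩ : AkT k) ∈ B

theorem mem_column {n : ℕ} {k : Fin n → ℕ} {B : Finset (AkT k)} {i : Fin n} {j : Fin (k i)} :
    j ∈ column B i ↔ (⟨i, j⟩ : AkT k) ∈ B := by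
  simp [column]

/-- A cube lies in `⊞^k` when its `1`s, and its `1`s together with its `*`s, are down-closed in
each column, and it has at most one `*` per column. -/
theorem cubeOn_mem_boxK {n : ℕ} {k : Fin n → ℕ} {O S : Finset (AkT k)} (hd : Disjoint O S)
    (hO : ∀ i, IsLowerSet (column O i : Set (Fin (k i))))
    (hOS : ∀ i, IsLowerSet (column (O ∪ S) i : Set (Fin (k i))))
    (hS : ∀ i, (column S i).card ≤ 1) : cubeOn O S ∈ boxK k := by
  refine ⟨fun i => (column O i).card, fun i => (column (O ∪ S) i).card,
    ⟨fun i => ?_, fun i => ?_⟩, fun i => by simp, fun i => ?_, ?_⟩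
  · have h : column O i ⊆ column (O ∪ S) i := fun j hj =>
      mem_column.2 (Finset.mem_union_left _ (mem_column.1 hj))
    exact Int.ofNat_le.2 (Finset.card_le_card h)
  · have h : column (O ∪ S) i ⊆ column O i ∪ column S i := fun j hj => by
      simpa [mem_column] using hj
    have h₁ := (Finset.card_le_card h).trans (Finset.card_union_le _ _)
    have h₂ := hS i
    show ((column (O ∪ S) i).card : ℤ) ≤ (column O i).card + 1
    omega
  · have := Finset.card_le_univ (column (O ∪ S) i)
    rw [Fintype.card_fin] at this
    exact Int.ofNat_le.2 this
  · funext ⟨i, j⟩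
    have h₁ := (mem_iff_lt_card_of_isLowerSet (hO i) j).symm.trans mem_column
    have h₂ := (mem_iff_lt_card_of_isLowerSet (hOS i) j).symm.trans mem_column
    have e₁ : ((j : ℕ) : ℤ) + 1 ≤ ((column O i).card : ℤ) ↔ (⟨i, j⟩ : AkT k) ∈ O := by
      rw [← h₁]; omega
    have e₂ : ((column (O ∪ S) i).card : ℤ) < ((j : ℕ) : ℤ) + 1 ↔
        (⟨i, j⟩ : AkT k) ∉ O ∪ S := by
      rw [← h₂]; omega
    have hdj : (⟨i, j⟩ : AkT k) ∈ O → (⟨i, j⟩ : AkT k) ∉ S := fun h =>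
      Finset.disjoint_left.1 hd h
    simp only [cubeOn, ik, jval, e₁, e₂, Finset.mem_union]
    split_ifs <;> tauto

/-- For `n ≥ 1`, `k ∈ ℤⁿ` with `k ≥ 0`, an ordered partition
`λ = B₁|…|B_l` of `A_k` belongs to `P_{⊞^k}` iff, for every `i` and `j < j'`,
whenever `(i,j) ∈ B_r` and `(i,j') ∈ B_{r'}` one has `r < r'`. -/
theorem stmt_14 (n : ℕ) (hn : 1 ≤ n) (k : Fin n → ℕ)
    (L : List (Finset (AkT k))) (hL : IsOPart Finset.univ L) :
    L ∈ PK (boxK k) ∅ Finset.univ ↔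
      ∀ (i : Fin n) (j j' : Fin (k i)) (r r' : ℕ)
        (hr : r < L.length) (hr' : r' < L.length),
        (⟨i, j⟩ : AkT k) ∈ L[r]'hr → (⟨i, j'⟩ : AkT k) ∈ L[r']'hr' →
          j < j' → r < r' := by
  constructor
  · rintro ⟨-, hK⟩ i j j' r r' hr hr' hj hj' hlt
    by_contra! hle
    obtain ⟨a, b, ⟨-, hab⟩, -, -, hc⟩ := hK r' hr'
    have hjO : (⟨i, j⟩ : AkT k) ∉ ∅ ∪ blocksUnion (L.take r') := by
      rw [Finset.empty_union, mem_blocksUnion_take]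
      rintro ⟨s, hs, hsr, hp⟩
      have := index_unique hL.2.1 hr hs hj hp
      omega
    have h₁ := congrFun hc ⟨i, j⟩
    have h₂ := congrFun hc ⟨i, j'⟩
    have hi := hab i
    have hlt' : (j : ℕ) < j' := hlt
    simp only [cubeOn, ik, jval, hj', hjO, if_true, if_false] at h₁ h₂
    clear hK hc hab
    grind
  · refine fun h => ⟨hL, fun r hr => ?_⟩
    rw [Finset.empty_union]
    have hlower : ∀ t i, IsLowerSet (column (blocksUnion (L.take t)) i : Set (Fin (k i))) := by
      intro t i j' j hle hj'
      rw [Finset.mem_coe, mem_column, mem_blocksUnion_take] at hj' ⊢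
      obtain ⟨s', hs', hst, hj'⟩ := hj'
      have hmem : (⟨i, j⟩ : AkT k) ∈ blocksUnion (L.take L.length) := by
        rw [List.take_length, hL.2.2]
        exact Finset.mem_univ _
      obtain ⟨s, hs, -, hj⟩ := (mem_blocksUnion_take _ _ _).1 hmem
      rcases hle.eq_or_lt with rfl | hlt
      · exact ⟨s', hs', hst, hj'⟩
      · exact ⟨s, hs, (h i j j' s s' hs hs' hj hj' hlt).trans hst, hj⟩
    have hsucc : blocksUnion (L.take r) ∪ L[r] = blocksUnion (L.take (r + 1)) := by
      ext p
      rw [Finset.mem_union, mem_blocksUnion, mem_blocksUnion, ← List.take_concat_get' L r hr]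
      simp only [List.mem_append, List.mem_singleton, or_and_right, exists_or, exists_eq_left]
    refine cubeOn_mem_boxK ?_ (hlower r) (fun i => hsucc ▸ hlower (r + 1) i) fun i => ?_
    · refine Finset.disjoint_left.2 fun p hp hpr => ?_
      obtain ⟨s, hs, hsr, hps⟩ := (mem_blocksUnion_take _ _ _).1 hp
      exact hsr.ne (index_unique hL.2.1 hs hr hps hpr)
    · refine Finset.card_le_one.2 fun j hj j' hj' => ?_
      rw [mem_column] at hj hj'
      rcases lt_trichotomy j j' with hlt | heq | hlt
      · exact absurd (h i j j' r r hr hr hj hj' hlt) (lt_irrefl r)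
      · exact heq
      · exact absurd (h i j' j r r hr hr hj' hj hlt) (lt_irrefl r)
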